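/- arXiv:1512.06238 — 10 statements merged into one kernel-verified Lean document; each statement's English description precedes it below -/
import Mathlib

section
/- Let N be a finite set with |N| = n ≥ 1, let S ⊆ N, and let t ≤ n and ℓ ≥ 1 be natural numbers with ℓ ≤ t. If T is a uniformly random subset of N of size t, then Pr[|S ∩ T| ≥ ℓ] ≤ (t · |S| / n)^ℓ; equivalently, the number of subsets T ⊆ N with |T| = t and |S ∩ T| ≥ ℓ is at most (t · |S| / n)^ℓ · C(n, t). In particular, if t · |S| / n ≤ n^{−ε} for some ε > 0, then Pr[|S ∩ T| ≥ ℓ] ≤ n^{−εℓ}. -/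
theorem Nat.descFactorial_mul_pow_le {t n : ℕ} (h : t ≤ n) (k : ℕ) :
    t.descFactorial k * n ^ k ≤ t ^ k * n.descFactorial k := by
  induction k with
  | zero => simp
  | succ k ih =>
    have hstep : (t - k) * n ≤ t * (n - k) := by
      rw [Nat.sub_mul, Nat.mul_sub]
      exact Nat.sub_le_sub_left (by rw [Nat.mul_comm t k]; exact Nat.mul_le_mul_left k h) _
    calc t.descFactorial (k + 1) * n ^ (k + 1)
        = ((t - k) * n) * (t.descFactorial k * n ^ k) := by
          rw [Nat.descFactorial_succ]; ring
      _ ≤ (t * (n - k)) * (t ^ k * n.descFactorial k) := Nat.mul_le_mul hstep ih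
      _ = t ^ (k + 1) * n.descFactorial (k + 1) := by
          rw [Nat.descFactorial_succ]; ring

theorem Nat.choose_mul_pow_le {t n : ℕ} (h : t ≤ n) (k : ℕ) :
    t.choose k * n ^ k ≤ t ^ k * n.choose k := by
  have hdesc := Nat.descFactorial_mul_pow_le h k
  rw [Nat.descFactorial_eq_factorial_mul_choose, Nat.descFactorial_eq_factorial_mul_choose] at hdesc
  refine Nat.le_of_mul_le_mul_left ?_ k.factorial_pos
  linarith

theorem Finset.card_filter_card_eq_and_superset_le {α : Type*} [Fintype α] [DecidableEq α]
    (t : ℕ) (U : Finset α) :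
    (Finset.univ.filter (fun T : Finset α => T.card = t ∧ U ⊆ T)).card
      ≤ (Fintype.card α - U.card).choose (t - U.card) := by
  rw [← Finset.card_compl, ← Finset.card_powersetCard]
  refine Finset.card_le_card_of_injOn (fun T => T \ U) ?_ ?_
  · intro T hT
    obtain ⟨hcard, hU⟩ : T.card = t ∧ U ⊆ T := by simpa using hT
    refine Finset.mem_coe.2 (Finset.mem_powersetCard.2 ⟨fun x hx => ?_, ?_⟩)
    · exact Finset.mem_compl.2 (Finset.mem_sdiff.1 hx).2
    · rw [Finset.card_sdiff_of_subset hU, hcard]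
  · intro T hT T' hT' hEq
    have hU : U ⊆ T := (Finset.mem_filter.1 (Finset.mem_coe.1 hT)).2.2
    have hU' : U ⊆ T' := (Finset.mem_filter.1 (Finset.mem_coe.1 hT')).2.2
    rw [← Finset.sdiff_union_of_subset hU, ← Finset.sdiff_union_of_subset hU']
    exact congrArg (· ∪ U) hEq

theorem Finset.card_filter_card_eq_and_le_card_inter_le {α : Type*} [Fintype α] [DecidableEq α]
    (t k : ℕ) (S : Finset α) :
    (Finset.univ.filter (fun T : Finset α => T.card = t ∧ k ≤ (S ∩ T).card)).card
      ≤ S.card.choose k * (Fintype.card α - k).choose (t - k) := by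
  have hsub : Finset.univ.filter (fun T : Finset α => T.card = t ∧ k ≤ (S ∩ T).card)
      ⊆ (S.powersetCard k).biUnion
        (fun U => Finset.univ.filter (fun T : Finset α => T.card = t ∧ U ⊆ T)) := by
    intro T hT
    obtain ⟨-, hcard, hk⟩ := Finset.mem_filter.1 hT
    obtain ⟨U, hU, hUk⟩ := Finset.exists_subset_card_eq hk
    refine Finset.mem_biUnion.2 ⟨U, Finset.mem_powersetCard.2
      ⟨hU.trans Finset.inter_subset_left, hUk⟩, ?_⟩
    exact Finset.mem_filter.2 ⟨Finset.mem_univ _, hcard, hU.trans Finset.inter_subset_right⟩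
  refine (Finset.card_le_card hsub).trans ?_
  rw [← Finset.card_powersetCard k S]
  refine Finset.card_biUnion_le_card_mul _ _ _ fun U hU => ?_
  simpa only [(Finset.mem_powersetCard.1 hU).2] using
    Finset.card_filter_card_eq_and_superset_le t U


/-- For a uniformly random `t`-element subset `T` of an `n`-element set and any `S`,
`Pr[|S ∩ T| ≥ ℓ] ≤ (t·|S|/n)^ℓ`; stated equivalently as a count: the number of
`t`-element subsets `T` with `|S ∩ T| ≥ ℓ` is at most `(t·|S|/n)^ℓ · C(n,t)`. -/
theorem stmt_1 {α : Type*} [Fintype α] [DecidableEq α] (n t ℓ : ℕ)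
    (hn : Fintype.card α = n) (hn1 : 1 ≤ n) (ht : t ≤ n) (hℓ1 : 1 ≤ ℓ) (hℓt : ℓ ≤ t)
    (S : Finset α) :
    ((Finset.univ.filter
        (fun T : Finset α => T.card = t ∧ ℓ ≤ (S ∩ T).card)).card : ℝ)
      ≤ ((t * S.card : ℝ) / n) ^ ℓ * (n.choose t) := by
  have hcount := Finset.card_filter_card_eq_and_le_card_inter_le t ℓ S
  rw [hn] at hcount
  have hratio : (n - ℓ).choose (t - ℓ) * n ^ ℓ ≤ t ^ ℓ * n.choose t := by
    refine Nat.le_of_mul_le_mul_left ?_ (Nat.choose_pos (hℓt.trans ht))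
    calc n.choose ℓ * ((n - ℓ).choose (t - ℓ) * n ^ ℓ)
        = n.choose t * (t.choose ℓ * n ^ ℓ) := by
          rw [← mul_assoc, ← Nat.choose_mul hℓt, mul_assoc]
      _ ≤ n.choose t * (t ^ ℓ * n.choose ℓ) :=
          Nat.mul_le_mul_left _ (Nat.choose_mul_pow_le ht ℓ)
      _ = n.choose ℓ * (t ^ ℓ * n.choose t) := by ring
  have hn0 : (0 : ℝ) < (n : ℝ) ^ ℓ := by positivity
  rw [div_pow, div_mul_eq_mul_div, le_div_iff₀ hn0]
  norm_cast
  calc _ ≤ S.card.choose ℓ * (n - ℓ).choose (t - ℓ) * n ^ ℓ := Nat.mul_le_mul_right _ hcount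
    _ = S.card.choose ℓ * ((n - ℓ).choose (t - ℓ) * n ^ ℓ) := mul_assoc _ _ _
    _ ≤ S.card ^ ℓ * (t ^ ℓ * n.choose t) :=
        Nat.mul_le_mul (Nat.choose_le_pow _ _) hratio
    _ = (t * S.card) ^ ℓ * n.choose t := by ring
end

section
/- For every natural number ℓ ≥ 1 there exist positive integers p₁ < p₂ < ⋯ < p_ℓ with j ≤ p_j ≤ j(j+1) for every 1 ≤ j ≤ ℓ, such that the ℓ × ℓ matrix A with rational entries A_{ij} = p_j · (1 − (1 − 1/p_j)^i), for i, j ∈ {1, …, ℓ}, is invertible (its determinant is nonzero). -/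
open Polynomial in
/-- The determinant of the matrix of partial geometric sums of `v j` is a Vandermonde
determinant. -/
theorem det_geom_sum_eq_det_vandermonde {R : Type*} [CommRing R] [Nontrivial R] {n : ℕ}
    (v : Fin n → R) :
    (Matrix.of fun i j : Fin n => ∑ k ∈ Finset.range ((i : ℕ) + 1), v j ^ k).det =
      (Matrix.vandermonde v).det := by
  rw [Matrix.det_eval_matrixOfPolynomials_eq_det_vandermonde v
    (fun i => ∑ k ∈ Finset.range ((i : ℕ) + 1), (X : R[X]) ^ k), ← Matrix.det_transpose]
  · congr 1
    ext i j
    simp [eval_finsetSum]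
  · intro i
    rw [Finset.sum_range_succ, add_comm, natDegree_add_eq_left_of_degree_lt, natDegree_X_pow]
    rw [degree_X_pow]
    exact (degree_sum_le _ _).trans_lt <| (Finset.sup_lt_iff (WithBot.bot_lt_coe _)).2
      fun k hk => by simpa using hk
  · intro i
    exact monic_geom_sum_X (Nat.succ_ne_zero _)

/-- There exist positive integers `p₁ < p₂ < ⋯ < p_ℓ` with `j ≤ p_j ≤ j(j+1)` such that
the `ℓ × ℓ` matrix with entries `A_{ij} = p_j · (1 − (1 − 1/p_j)^i)` (for `i, j ∈ {1,…,ℓ}`,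
here indexed by `Fin ℓ` via `j ↦ j+1`) is invertible over `ℚ`. -/
theorem stmt_3 (ℓ : ℕ) (hℓ : 1 ≤ ℓ) :
    ∃ p : Fin ℓ → ℕ, StrictMono p ∧
      (∀ j : Fin ℓ, (j : ℕ) + 1 ≤ p j ∧ p j ≤ ((j : ℕ) + 1) * ((j : ℕ) + 2)) ∧
      (Matrix.of fun i j : Fin ℓ =>
          (p j : ℚ) * (1 - (1 - 1 / (p j : ℚ)) ^ ((i : ℕ) + 1))).det ≠ 0 := by
  refine ⟨fun j => j + 1, fun i j hij => by simpa using hij, fun j => ⟨le_rfl, by nlinarith⟩, ?_⟩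
  have key := det_geom_sum_eq_det_vandermonde
    fun j : Fin ℓ => 1 - 1 / (((j : ℕ) + 1 : ℕ) : ℚ)
  have entry : ∀ i j : Fin ℓ, ((((j : ℕ) + 1 : ℕ) : ℚ) *
      (1 - (1 - 1 / (((j : ℕ) + 1 : ℕ) : ℚ)) ^ ((i : ℕ) + 1))) =
      ∑ k ∈ Finset.range ((i : ℕ) + 1), (1 - 1 / (((j : ℕ) + 1 : ℕ) : ℚ)) ^ k := by
    intro i j
    have h : (((j : ℕ) + 1 : ℕ) : ℚ) ≠ 0 := by positivity
    rw [← mul_neg_geom_sum]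
    field_simp
    ring
  simp only [entry]
  rw [key, Matrix.det_vandermonde_ne_zero_iff]
  intro i j hij
  simpa [Fin.ext_iff] using hij
end

section
/- There is an absolute constant c > 0 with the following property. For every natural number ℓ ≥ 2 and all positive integers p₁, …, p_ℓ with j ≤ p_j ≤ j(j+1) for every 1 ≤ j ≤ ℓ, if the ℓ × ℓ matrix A with entries A_{ij} = p_j · (1 − (1 − 1/p_j)^i) (i, j ∈ {1, …, ℓ}) is invertible, then the unique solution x⋆ ∈ ℚ^ℓ of the linear system A x = y, where y_i = i for i ∈ {1, …, ℓ}, satisfies |x⋆_i| ≤ ℓ^{c·ℓ⁴} for every i. -/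
/-- If scaling the columns of a rational matrix by factors of absolute value at most `D` makes it
an integer matrix, a nonzero determinant is at least `D ^ (-n)` in absolute value. -/
theorem Matrix.one_le_pow_mul_abs_det_of_col_scaling {n : Type*} [Fintype n] [DecidableEq n]
    (A : Matrix n n ℚ) (M : Matrix n n ℤ) (d : n → ℚ) (D : ℚ)
    (hM : ∀ i j, (M i j : ℚ) = d j * A i j) (hd : ∀ j, d j ≠ 0) (hD : ∀ j, |d j| ≤ D)
    (hA : A.det ≠ 0) : 1 ≤ D ^ Fintype.card n * |A.det| := by
  have hdet : (M.det : ℚ) = (∏ j, d j) * A.det := by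
    rw [← Matrix.det_mul_row, Int.cast_det]
    congr 1
    ext i j
    simp [hM]
  have hne : M.det ≠ 0 := by
    intro h
    rw [h, Int.cast_zero, eq_comm, mul_eq_zero, Finset.prod_eq_zero_iff] at hdet
    rcases hdet with ⟨j, -, hj⟩ | h
    · exact hd j hj
    · exact hA h
  have hprod : |∏ j, d j| ≤ D ^ Fintype.card n := by
    rw [Finset.abs_prod]
    exact (Finset.prod_le_prod (fun j _ => abs_nonneg _) fun j _ => hD j).trans_eq (by simp)
  calc (1 : ℚ) ≤ |(M.det : ℚ)| := mod_cast Int.one_le_abs hne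
    _ = |∏ j, d j| * |A.det| := by rw [hdet, abs_mul]
    _ ≤ D ^ Fintype.card n * |A.det| := by gcongr

/-- Cramer's rule as a bound: entries of the data at most `b` bound `det A * x i`. -/
theorem Matrix.abs_det_mul_abs_le_of_mulVec_eq {n : Type*} [Fintype n] [DecidableEq n]
    (A : Matrix n n ℚ) (x y : n → ℚ) (b : ℚ) (hA : ∀ i j, |A i j| ≤ b) (hy : ∀ i, |y i| ≤ b)
    (h : A.mulVec x = y) (i : n) :
    |A.det| * |x i| ≤ (Fintype.card n).factorial * b ^ Fintype.card n := by
  have hcr : A.det * x i = (A.updateCol i y).det := by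
    rw [← Matrix.cramer_apply, Matrix.cramer_eq_adjugate_mulVec, ← h, Matrix.mulVec_mulVec,
      Matrix.adjugate_mul, Matrix.smul_mulVec, Matrix.one_mulVec, Pi.smul_apply, smul_eq_mul]
  rw [← abs_mul, hcr, ← nsmul_eq_mul]
  refine Matrix.det_le (abv := AbsoluteValue.abs) fun k j => ?_
  change |A.updateCol i y k j| ≤ b
  rw [Matrix.updateCol_apply]
  split_ifs
  · exact hy k
  · exact hA k j

/-- There is an absolute constant `c > 0` such that for every `ℓ ≥ 2` and positive integers
`p_j` with `j ≤ p_j ≤ j(j+1)`, if the matrix `A` with entries `A_{ij} = p_j(1−(1−1/p_j)^i)`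
is invertible then the unique solution `x⋆` of `A x = y` (where `y_i = i`) satisfies
`|x⋆_i| ≤ ℓ^{c·ℓ⁴}` for every `i`. -/
theorem stmt_4 :
    ∃ c : ℝ, 0 < c ∧
      ∀ (ℓ : ℕ), 2 ≤ ℓ → ∀ p : Fin ℓ → ℕ,
        (∀ j : Fin ℓ, (j : ℕ) + 1 ≤ p j ∧ p j ≤ ((j : ℕ) + 1) * ((j : ℕ) + 2)) →
        ∀ A : Matrix (Fin ℓ) (Fin ℓ) ℚ,
          (∀ i j : Fin ℓ, A i j = (p j : ℚ) * (1 - (1 - 1 / (p j : ℚ)) ^ ((i : ℕ) + 1))) →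
          A.det ≠ 0 →
          ∀ x : Fin ℓ → ℚ,
            A.mulVec x = (fun i : Fin ℓ => ((i : ℕ) + 1 : ℚ)) →
            ∀ i : Fin ℓ, ((|x i| : ℚ) : ℝ) ≤ (ℓ : ℝ) ^ (c * (ℓ : ℝ) ^ 4) := by
  refine ⟨7, by norm_num, ?_⟩
  intro ℓ hℓ p hp A hA hdet x hx i
  have hp1 : ∀ j, 1 ≤ p j := fun j => by have := (hp j).1; omega
  have hp0 : ∀ j, (p j : ℚ) ≠ 0 := fun j => by have := hp1 j; positivity
  have hpℓ : ∀ j, p j ≤ ℓ ^ 3 := fun j => by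
    have hj : (j : ℕ) + 1 ≤ ℓ := j.2
    calc p j ≤ ((j : ℕ) + 1) * ((j : ℕ) + 2) := (hp j).2
      _ ≤ ℓ * (ℓ * ℓ) := Nat.mul_le_mul hj (by nlinarith)
      _ = ℓ ^ 3 := by ring
  have hpℓ' : ∀ j, (p j : ℚ) ≤ (ℓ : ℚ) ^ 3 := fun j => mod_cast hpℓ j
  have hℓ1 : (1 : ℚ) ≤ ℓ := by exact_mod_cast (by omega : 1 ≤ ℓ)
  have hentry : ∀ k j, |A k j| ≤ (ℓ : ℚ) ^ 3 := fun k j => by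
    have h1 : (1 : ℚ) ≤ p j := mod_cast hp1 j
    have hq0 : (0 : ℚ) ≤ 1 - 1 / p j := by
      rw [sub_nonneg, div_le_one (by positivity)]
      exact h1
    have hq1 : (1 : ℚ) - 1 / p j ≤ 1 := sub_le_self _ (by positivity)
    have hpow0 := pow_nonneg hq0 ((k : ℕ) + 1)
    have hpow1 := pow_le_one₀ (n := (k : ℕ) + 1) hq0 hq1
    rw [hA, abs_of_nonneg (mul_nonneg (by positivity) (by linarith))]
    exact (mul_le_of_le_one_right (by positivity) (by linarith)).trans (hpℓ' j)
  have hrhs : ∀ k : Fin ℓ, |((k : ℕ) + 1 : ℚ)| ≤ (ℓ : ℚ) ^ 3 := fun k => by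
    rw [abs_of_nonneg (by positivity)]
    have hk : ((k : ℕ) + 1 : ℚ) ≤ ℓ := mod_cast k.2
    exact hk.trans (le_self_pow₀ hℓ1 (by norm_num))
  have hlower := Matrix.one_le_pow_mul_abs_det_of_col_scaling A
    (Matrix.of fun k j : Fin ℓ => (p j : ℤ) *
      ((p j : ℤ) ^ ℓ - (p j : ℤ) ^ (ℓ - ((k : ℕ) + 1)) * ((p j : ℤ) - 1) ^ ((k : ℕ) + 1)))
    (fun j => (p j : ℚ) ^ ℓ) (((ℓ : ℚ) ^ 3) ^ ℓ)
    (fun k j => by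
      have hsplit : (p j : ℚ) ^ ℓ = (p j : ℚ) ^ (ℓ - ((k : ℕ) + 1)) * (p j : ℚ) ^ ((k : ℕ) + 1) := by
        rw [← pow_add, Nat.sub_add_cancel k.2]
      have hbase : (p j : ℚ) - 1 = p j * (1 - 1 / p j) := by
        have := hp0 j
        field_simp
      rw [hA, Matrix.of_apply]
      push_cast
      rw [hbase, mul_pow, hsplit]
      ring)
    (fun j => pow_ne_zero _ (hp0 j))
    (fun j => by
      rw [abs_of_nonneg (by positivity)]
      exact pow_le_pow_left₀ (by positivity) (hpℓ' j) ℓ)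
    hdet
  have hupper := Matrix.abs_det_mul_abs_le_of_mulVec_eq A x _ _ hentry hrhs hx i
  rw [Fintype.card_fin] at hlower hupper
  have hfact : (ℓ.factorial : ℚ) ≤ (ℓ : ℚ) ^ ℓ := mod_cast Nat.factorial_le_pow ℓ
  have hbound : |x i| ≤ (ℓ : ℚ) ^ (7 * ℓ ^ 4) := by
    calc |x i| ≤ (((ℓ : ℚ) ^ 3) ^ ℓ) ^ ℓ * |A.det| * |x i| :=
          le_mul_of_one_le_left (abs_nonneg _) hlower
      _ = (((ℓ : ℚ) ^ 3) ^ ℓ) ^ ℓ * (|A.det| * |x i|) := mul_assoc _ _ _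
      _ ≤ (((ℓ : ℚ) ^ 3) ^ ℓ) ^ ℓ * (ℓ.factorial * ((ℓ : ℚ) ^ 3) ^ ℓ) := by gcongr
      _ ≤ (((ℓ : ℚ) ^ 3) ^ ℓ) ^ ℓ * ((ℓ : ℚ) ^ ℓ * ((ℓ : ℚ) ^ 3) ^ ℓ) := by gcongr
      _ = (ℓ : ℚ) ^ (3 * ℓ * ℓ + (ℓ + 3 * ℓ)) := by rw [pow_add, pow_add, pow_mul, pow_mul]
      _ ≤ (ℓ : ℚ) ^ (7 * ℓ ^ 4) := by
          refine pow_le_pow_right₀ hℓ1 ?_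
          have h1 : ℓ ≤ ℓ ^ 4 := Nat.le_self_pow (by norm_num) ℓ
          have h2 : ℓ ^ 2 ≤ ℓ ^ 4 := Nat.pow_le_pow_right (by omega) (by norm_num)
          nlinarith
  have hcast : ((|x i| : ℚ) : ℝ) ≤ (ℓ : ℝ) ^ (7 * ℓ ^ 4) := mod_cast hbound
  refine hcast.trans_eq ?_
  rw [← Real.rpow_natCast]
  push_cast
  rfl
end

section
/- Let f be a coverage function on a finite ground set E with |E| = k, given by children A, parent sets P(a) ⊆ E, and nonnegative weights w(a), such that every child has exactly z parents (|P(a)| = z for all a ∈ A, where 1 ≤ z ≤ k). Suppose f is symmetric on sets of size at most ℓ for some ℓ ≤ k, i.e., f(S) depends only on |S| whenever |S| ≤ ℓ; write f(y) for the common value on sets of size y ≤ ℓ. Then for every 1 ≤ y ≤ ℓ: f(y) = f(y−1) + z · (f(E) − f(y−1)) / (k − y + 1). -/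
/-- If every child has exactly `z ≥ 1` parents, the marginal gains of a coverage function at `T`
sum to `z` times the weight left uncovered by `T`. -/
theorem sum_coverage_marginal {α ι : Type*} [Fintype α] [DecidableEq α] [Fintype ι]
    {z : ℕ} (hz : 1 ≤ z) (P : ι → Finset α) (w : ι → ℝ) (hP : ∀ a, (P a).card = z)
    (f : Finset α → ℝ)
    (hf : ∀ S, f S = ∑ a ∈ Finset.univ.filter (fun a : ι => (P a ∩ S).Nonempty), w a)
    (T : Finset α) :
    ∑ e, (f (insert e T) - f T) = z * (f Finset.univ - f T) := by
  simp only [hf, Finset.sum_filter, ← Finset.sum_sub_distrib]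
  rw [Finset.sum_comm, Finset.mul_sum]
  refine Finset.sum_congr rfl fun a _ => ?_
  have hne : (P a).Nonempty := Finset.card_pos.mp (by rw [hP]; exact hz)
  by_cases h : (P a ∩ T).Nonempty
  · have hins (e : α) : (P a ∩ insert e T).Nonempty :=
      h.mono (Finset.inter_subset_inter_left (Finset.subset_insert e T))
    simp [h, hne, hins]
  · have hins (e : α) : (P a ∩ insert e T).Nonempty ↔ e ∈ P a := by
      rw [Finset.not_nonempty_iff_eq_empty] at h
      by_cases he : e ∈ P a
      · simp [Finset.inter_insert_of_mem he, he]
      · simp [Finset.inter_insert_of_notMem he, he, h]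
    simp [h, hne, hins, hP]


/-- Recursion for symmetric coverage functions with `z` parents per child: if `f` is a
coverage function on a `k`-element ground set, every child has exactly `z` parents, and
`f(S)` depends only on `|S|` for `|S| ≤ ℓ`, then for `1 ≤ y ≤ ℓ`,
`f(y) = f(y−1) + z·(f(E) − f(y−1))/(k − y + 1)`. -/
theorem stmt_7 {α ι : Type*} [Fintype α] [DecidableEq α] [Fintype ι]
    (k z ℓ : ℕ) (hk : Fintype.card α = k) (hz1 : 1 ≤ z) (hzk : z ≤ k) (hℓk : ℓ ≤ k)
    (P : ι → Finset α) (w : ι → ℝ) (hw : ∀ a, 0 ≤ w a) (hP : ∀ a, (P a).card = z)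
    (f : Finset α → ℝ)
    (hf : ∀ S, f S = ∑ a ∈ Finset.univ.filter (fun a : ι => (P a ∩ S).Nonempty), w a)
    (hsym : ∀ S S' : Finset α, S.card = S'.card → S.card ≤ ℓ → f S = f S')
    (y : ℕ) (hy1 : 1 ≤ y) (hyℓ : y ≤ ℓ)
    (S : Finset α) (hS : S.card = y) (S' : Finset α) (hS' : S'.card = y - 1) :
    f S = f S' + z * (f Finset.univ - f S') / ((k : ℝ) - y + 1) := by
  have hyk : y ≤ k := hyℓ.trans hℓk
  have hpos : (0 : ℝ) < (k : ℝ) - y + 1 := by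
    have : (y : ℝ) ≤ k := by exact_mod_cast hyk
    linarith
  have hgain : ∑ e, (f (insert e S') - f S') = ((k : ℝ) - y + 1) * (f S - f S') := by
    have hterm (e : α) : f (insert e S') - f S' = if e ∈ S'ᶜ then f S - f S' else 0 := by
      by_cases he : e ∈ S'
      · simp [he]
      · have hcard : (insert e S').card = y := by
          rw [Finset.card_insert_of_notMem he, hS']
          omega
        rw [if_pos (Finset.mem_compl.mpr he),
          hsym (insert e S') S (hcard.trans hS.symm) (hcard.trans_le hyℓ)]
    have hcompl : ((S'ᶜ).card : ℝ) = (k : ℝ) - y + 1 := by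
      rw [Finset.card_compl, hk, hS', Nat.cast_sub (by omega), Nat.cast_sub hy1]
      push_cast
      ring
    simp only [hterm, Finset.sum_ite_mem, Finset.univ_inter, Finset.sum_const, nsmul_eq_mul,
      hcompl]
  rw [← sum_coverage_marginal hz1 P w hP f hf S', hgain, mul_div_cancel_left₀ _ hpos.ne']
  ring
end

section
/- Let N be a finite set with |N| = n ≥ 1 and let f : 2^N → ℝ be monotone, submodular, and normalized. Then for every 1 ≤ k ≤ n, the average value of f over all k-element subsets of N is at least (k/n) · f(N); that is, (1/C(n,k)) · Σ_{S ⊆ N, |S| = k} f(S) ≥ (k/n) · f(N). -/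
/-- A normalized submodular function on a set of size `m + 1` has sum over the `(k + 1)`-subsets
at least `C(m, k)` times its value on the whole set. -/
theorem choose_mul_le_sum_powersetCard {α : Type*} [DecidableEq α] (m : ℕ) :
    ∀ (s : Finset α) (f : Finset α → ℝ) (k : ℕ), s.card = m + 1 →
      (∀ S T : Finset α, f (S ∪ T) + f (S ∩ T) ≤ f S + f T) → f ∅ = 0 →
      (m.choose k : ℝ) * f s ≤ ∑ S ∈ s.powersetCard (k + 1), f S := by
  induction m with
  | zero =>
    intro s f k hs _ _
    obtain ⟨x, rfl⟩ := Finset.card_eq_one.mp hs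
    cases k with
    | zero => simp [Finset.powersetCard_one]
    | succ k => rw [Finset.powersetCard_eq_empty.mpr (by simp)]; simp
  | succ m ih =>
    intro s f k hs hsub h0
    obtain ⟨x, t, hx, rfl, ht⟩ := Finset.card_eq_succ.mp hs
    have hxt : f (insert x t) ≤ f {x} + f t := by
      have h := hsub {x} t
      rw [Finset.singleton_inter_of_notMem hx, h0, ← Finset.insert_eq] at h
      linarith
    rw [Finset.powersetCard_succ_insert hx, Finset.sum_union, Finset.sum_image]
    · have h1 := ih t f k ht hsub h0
      cases k with
      | zero =>
        simp only [Nat.choose_zero_right, Nat.cast_one, one_mul, Finset.powersetCard_zero,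
          Finset.sum_singleton, insert_empty_eq] at h1 ⊢
        linarith
      | succ k =>
        have h2 := ih t (fun S => f (insert x S) - f {x}) k ht (fun S T => by
          have h := hsub (insert x S) (insert x T)
          rw [← Finset.insert_union_distrib, ← Finset.insert_inter_distrib] at h
          linarith) (by simp)
        simp only [Finset.sum_sub_distrib, Finset.sum_const, Finset.card_powersetCard, ht,
          nsmul_eq_mul] at h2
        have h3 := mul_le_mul_of_nonneg_left hxt (Nat.cast_nonneg (α := ℝ) (m.choose (k + 1)))
        rw [Nat.choose_succ_succ] at h2 ⊢
        push_cast at h2 ⊢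
        linarith
    · intro S hS T hT h
      have hS' : x ∉ S := fun h => hx ((Finset.mem_powersetCard.mp hS).1 h)
      have hT' : x ∉ T := fun h => hx ((Finset.mem_powersetCard.mp hT).1 h)
      rw [← Finset.erase_insert hS', ← Finset.erase_insert hT', h]
    · rw [Finset.disjoint_left]
      rintro S hS hS'
      obtain ⟨T, -, rfl⟩ := Finset.mem_image.mp hS'
      exact hx ((Finset.mem_powersetCard.mp hS).1 (Finset.mem_insert_self x T))

/-- For a monotone, submodular, normalized `f` on an `n`-element ground set, the average
value of `f` over all `k`-element subsets is at least `(k/n)·f(N)`. -/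
theorem stmt_8 {α : Type*} [Fintype α] [DecidableEq α] (n : ℕ)
    (hn : Fintype.card α = n) (hn1 : 1 ≤ n)
    (f : Finset α → ℝ)
    (hmono : ∀ S T : Finset α, S ⊆ T → f S ≤ f T)
    (hsub : ∀ S T : Finset α, f (S ∪ T) + f (S ∩ T) ≤ f S + f T)
    (hnorm : f ∅ = 0)
    (k : ℕ) (hk1 : 1 ≤ k) (hkn : k ≤ n) :
    ((k : ℝ) / n) * f Finset.univ
      ≤ (1 / (n.choose k : ℝ)) * ∑ S ∈ Finset.powersetCard k (Finset.univ : Finset α), f S := by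
  obtain ⟨m, rfl⟩ := Nat.exists_eq_add_of_le' hn1
  obtain ⟨j, rfl⟩ := Nat.exists_eq_add_of_le' hk1
  have h := choose_mul_le_sum_powersetCard m Finset.univ f j hn hsub hnorm
  have hc : (0 : ℝ) < ((m + 1).choose (j + 1) : ℝ) := by
    exact_mod_cast Nat.choose_pos hkn
  have hm : ((m + 1 : ℕ) : ℝ) * (m.choose j : ℝ)
      = ((m + 1).choose (j + 1) : ℝ) * ((j + 1 : ℕ) : ℝ) := by
    exact_mod_cast Nat.add_one_mul_choose_eq m j
  have hpos : (0 : ℝ) < ((m + 1 : ℕ) : ℝ) := by positivity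
  have hratio : ((j + 1 : ℕ) : ℝ) / ((m + 1 : ℕ) : ℝ)
      = (m.choose j : ℝ) / ((m + 1).choose (j + 1) : ℝ) := by
    rw [div_eq_div_iff hpos.ne' hc.ne']
    linarith
  rw [hratio, one_div_mul_eq_div, div_mul_eq_mul_div]
  gcongr
end

section
/- Let N be a finite set with |N| = n and let f : 2^N → ℝ be monotone, submodular, and normalized. Let 1 ≤ k ≤ n, 1 ≤ m ≤ n, and let S⋆ ⊆ N with |S⋆| = k. If the average of f over all m-element subsets of N is at least f(S⋆)/4, then the average of f over all k-element subsets of N is at least min(1/4, k/(4m)) · f(S⋆). (The paper applies this with m = √n: if a uniformly random set of size √n has expected value at least f(S⋆)/4, then a uniformly random set of size k is a min(1/4, k/(4√n))-approximation to f(S⋆).) -/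
open Finset in
/-- Double counting of the pairs of a `j`-element set and a one-point extension of it. -/
theorem sum_powersetCard_succ_sum_erase {α : Type*} [Fintype α] [DecidableEq α]
    (f : Finset α → ℝ) (j : ℕ) :
    ∑ T ∈ powersetCard (j + 1) (univ : Finset α), ∑ x ∈ T, f (T.erase x)
      = ((Fintype.card α - j : ℕ) : ℝ) * ∑ S ∈ powersetCard j (univ : Finset α), f S := by
  have h : ∑ S ∈ powersetCard j (univ : Finset α), ∑ _x ∈ Sᶜ, f S
      = ((Fintype.card α - j : ℕ) : ℝ) * ∑ S ∈ powersetCard j (univ : Finset α), f S := by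
    rw [mul_sum]
    refine sum_congr rfl fun S hS => ?_
    rw [sum_const, card_compl, (mem_powersetCard.1 hS).2, nsmul_eq_mul]
  rw [← h, sum_sigma', sum_sigma']
  refine sum_bij' (fun p _ => ⟨p.1.erase p.2, p.2⟩) (fun p _ => ⟨insert p.2 p.1, p.2⟩)
    ?_ ?_ ?_ ?_ ?_
  · rintro ⟨T, x⟩ h
    simp only [mem_sigma, mem_powersetCard, subset_univ, true_and] at h
    simp [card_erase_of_mem h.2, h.1]
  · rintro ⟨S, x⟩ h
    simp only [mem_sigma, mem_powersetCard, subset_univ, true_and, mem_compl] at h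
    simp [card_insert_of_notMem h.2, h.1]
  · rintro ⟨T, x⟩ h
    simp only [mem_sigma] at h
    simp [insert_erase h.2]
  · rintro ⟨S, x⟩ h
    simp only [mem_sigma, mem_compl] at h
    simp [erase_insert h.2]
  · rintro ⟨T, x⟩ _
    rfl

/-- The marginal losses of a submodular function from deleting single points of `U ⊆ T` from `T`
add up to at most `f U - f ∅`. -/
theorem sum_sub_erase_le_of_submodular {α : Type*} [DecidableEq α] {f : Finset α → ℝ}
    (hsub : ∀ S T : Finset α, f (S ∪ T) + f (S ∩ T) ≤ f S + f T) (T U : Finset α) (hU : U ⊆ T) :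
    ∑ x ∈ U, (f T - f (T.erase x)) ≤ f U - f ∅ := by
  induction U using Finset.induction_on with
  | empty => simp
  | insert a U ha ih =>
    rw [Finset.insert_subset_iff] at hU
    rw [Finset.sum_insert ha]
    have hunion : insert a U ∪ T.erase a = T := by
      ext x
      have := @hU.2 x
      by_cases hx : x = a
      · simp [hx, hU.1]
      · simpa [hx] using this
    have hinter : insert a U ∩ T.erase a = U := by
      ext x
      have := @hU.2 x
      by_cases hx : x = a
      · simp [hx, ha]
      · simpa [hx] using this
    have h := hsub (insert a U) (T.erase a)
    rw [hunion, hinter] at h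
    linarith [ih hU.2]

/-- The average of `f` over all `j`-element subsets. -/
noncomputable def sliceAverage {α : Type*} [Fintype α] (f : Finset α → ℝ) (j : ℕ) : ℝ :=
  (1 / ((Fintype.card α).choose j : ℝ)) *
    ∑ S ∈ Finset.powersetCard j (Finset.univ : Finset α), f S

open Finset in
/-- The `j`-slice average, as an average over pairs of a `(j + 1)`-element set and a point
deleted from it. -/
theorem succ_mul_sliceAverage {α : Type*} [Fintype α] [DecidableEq α] (f : Finset α → ℝ) {j : ℕ}
    (hj : j < Fintype.card α) :
    (j + 1 : ℝ) * sliceAverage f j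
      = sliceAverage (fun T => ∑ x ∈ T, f (T.erase x)) (j + 1) := by
  have hc : ((Fintype.card α).choose (j + 1) : ℝ) * (j + 1)
      = (Fintype.card α).choose j * ((Fintype.card α - j : ℕ) : ℝ) := by
    exact_mod_cast Nat.choose_succ_right_eq (Fintype.card α) j
  have h0 : ((Fintype.card α).choose j : ℝ) ≠ 0 := by
    exact_mod_cast (Nat.choose_pos hj.le).ne'
  have h1 : ((Fintype.card α).choose (j + 1) : ℝ) ≠ 0 := by
    exact_mod_cast (Nat.choose_pos hj).ne'
  rw [sliceAverage, sliceAverage, sum_powersetCard_succ_sum_erase]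
  field_simp
  linear_combination (∑ S ∈ powersetCard j (univ : Finset α), f S) * hc

theorem sliceAverage_mono {α : Type*} [Fintype α] {f g : Finset α → ℝ} {j : ℕ}
    (h : ∀ T : Finset α, T.card = j → f T ≤ g T) : sliceAverage f j ≤ sliceAverage g j :=
  mul_le_mul_of_nonneg_left
    (Finset.sum_le_sum fun T hT => h T (Finset.mem_powersetCard.1 hT).2) (by positivity)

theorem sliceAverage_const_mul {α : Type*} [Fintype α] (f : Finset α → ℝ) (c : ℝ) (j : ℕ) :
    sliceAverage (fun T => c * f T) j = c * sliceAverage f j := by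
  rw [sliceAverage, sliceAverage, ← Finset.mul_sum]
  ring

/-- Slice averages of a monotone function are nondecreasing. -/
theorem sliceAverage_le_of_monotone {α : Type*} [Fintype α] [DecidableEq α] {f : Finset α → ℝ}
    (hmono : ∀ S T : Finset α, S ⊆ T → f S ≤ f T) {i j : ℕ} (hij : i ≤ j)
    (hj : j ≤ Fintype.card α) : sliceAverage f i ≤ sliceAverage f j := by
  induction j, hij using Nat.le_induction with
  | base => exact le_rfl
  | succ j _ ih =>
    refine (ih (by omega)).trans (le_of_mul_le_mul_left ?_ (by positivity : (0 : ℝ) < j + 1))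
    rw [succ_mul_sliceAverage f hj, ← sliceAverage_const_mul]
    refine sliceAverage_mono fun T hT => ?_
    calc ∑ x ∈ T, f (T.erase x) ≤ ∑ _x ∈ T, f T :=
          Finset.sum_le_sum fun x _ => hmono _ _ (T.erase_subset x)
      _ = (j + 1) * f T := by simp [hT]

/-- Slice averages of a normalized submodular function, divided by the slice size,
are nonincreasing. -/
theorem mul_sliceAverage_le_of_submodular {α : Type*} [Fintype α] [DecidableEq α]
    {f : Finset α → ℝ} (hsub : ∀ S T : Finset α, f (S ∪ T) + f (S ∩ T) ≤ f S + f T)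
    (hnorm : f ∅ = 0) {i j : ℕ} (hi : 1 ≤ i) (hij : i ≤ j) (hj : j ≤ Fintype.card α) :
    (i : ℝ) * sliceAverage f j ≤ j * sliceAverage f i := by
  induction j, hij using Nat.le_induction with
  | base => exact le_rfl
  | succ j hij ih =>
    have hstep : (j : ℝ) * sliceAverage f (j + 1) ≤ (j + 1) * sliceAverage f j := by
      rw [succ_mul_sliceAverage f hj, ← sliceAverage_const_mul]
      refine sliceAverage_mono fun T hT => ?_
      have h := sum_sub_erase_le_of_submodular hsub T T subset_rfl
      rw [Finset.sum_sub_distrib, Finset.sum_const, hT, hnorm, nsmul_eq_mul] at h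
      push_cast at h
      linarith
    have hj0 : (0 : ℝ) < j := by exact_mod_cast (by omega : 0 < j)
    refine le_of_mul_le_mul_left ?_ hj0
    calc (j : ℝ) * (i * sliceAverage f (j + 1)) = i * (j * sliceAverage f (j + 1)) := by ring
      _ ≤ i * ((j + 1) * sliceAverage f j) := by gcongr
      _ = (j + 1) * (i * sliceAverage f j) := by ring
      _ ≤ (j + 1) * (j * sliceAverage f i) :=
          mul_le_mul_of_nonneg_left (ih (by omega)) (by positivity)
      _ = j * ((j + 1 : ℕ) * sliceAverage f i) := by push_cast; ring


/-- If the average of a monotone, submodular, normalized `f` over all `m`-element subsets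
is at least `f(S⋆)/4` (with `|S⋆| = k`), then the average of `f` over all `k`-element
subsets is at least `min(1/4, k/(4m)) · f(S⋆)`. -/
theorem stmt_9 {α : Type*} [Fintype α] [DecidableEq α] (n : ℕ)
    (hn : Fintype.card α = n)
    (f : Finset α → ℝ)
    (hmono : ∀ S T : Finset α, S ⊆ T → f S ≤ f T)
    (hsub : ∀ S T : Finset α, f (S ∪ T) + f (S ∩ T) ≤ f S + f T)
    (hnorm : f ∅ = 0)
    (k m : ℕ) (hk1 : 1 ≤ k) (hkn : k ≤ n) (hm1 : 1 ≤ m) (hmn : m ≤ n)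
    (Sstar : Finset α) (hstar : Sstar.card = k)
    (havg : f Sstar / 4
      ≤ (1 / (n.choose m : ℝ)) * ∑ S ∈ Finset.powersetCard m (Finset.univ : Finset α), f S) :
    min (1 / 4 : ℝ) ((k : ℝ) / (4 * m)) * f Sstar
      ≤ (1 / (n.choose k : ℝ)) * ∑ S ∈ Finset.powersetCard k (Finset.univ : Finset α), f S := by
  subst hn
  change f Sstar / 4 ≤ sliceAverage f m at havg
  change _ ≤ sliceAverage f k
  have hpos : 0 ≤ f Sstar := hnorm ▸ hmono ∅ Sstar (Finset.empty_subset _)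
  rcases le_total m k with hmk | hkm
  · calc min (1 / 4 : ℝ) ((k : ℝ) / (4 * m)) * f Sstar ≤ 1 / 4 * f Sstar := by
          gcongr
          exact min_le_left _ _
      _ ≤ sliceAverage f m := by linarith
      _ ≤ sliceAverage f k := sliceAverage_le_of_monotone hmono hmk hkn
  · have hm0 : (0 : ℝ) < m := by exact_mod_cast hm1
    calc min (1 / 4 : ℝ) ((k : ℝ) / (4 * m)) * f Sstar ≤ (k : ℝ) / (4 * m) * f Sstar := by
          gcongr
          exact min_le_right _ _
      _ = k * (f Sstar / 4) / m := by field_simp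
      _ ≤ k * sliceAverage f m / m := by gcongr
      _ ≤ sliceAverage f k := by
          rw [div_le_iff₀' hm0]
          exact mul_sliceAverage_le_of_submodular hsub hnorm hk1 hkm hmn
end

section
/- Let N be a finite set with |N| = n ≥ 1 and let f : 2^N → ℝ be monotone, submodular, and normalized. Let f̃ : 2^N → ℝ satisfy (1 − 1/n²)·f(S) ≤ f̃(S) ≤ (1 + 1/n²)·f(S) for every S ⊆ N. Let 1 ≤ k ≤ n and let e₁, …, e_k ∈ N with S₀ = ∅ and S_i = S_{i−1} ∪ {e_i} be chosen greedily with respect to f̃, i.e., for every i ∈ {1, …, k} and every e ∈ N, f̃(S_i) ≥ f̃(S_{i−1} ∪ {e}). Then for every S⋆ ⊆ N with |S⋆| ≤ k: f(S_k) ≥ ((1 − 1/n²)/(1 + 1/n²))^k · (1 − (1 − 1/k)^k) · f(S⋆). In particular f(S_k) ≥ (1 − 2k/n²)(1 − 1/e) · f(S⋆). -/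
/-- For a monotone submodular function, adding `T` to `A` gains at most `|T|` times any bound on
the gain from adding a single element. -/
theorem submodular_union_le_add_card_mul {α : Type*} [DecidableEq α] {f : Finset α → ℝ}
    (hmono : ∀ S T : Finset α, S ⊆ T → f S ≤ f T)
    (hsub : ∀ S T : Finset α, f (S ∪ T) + f (S ∩ T) ≤ f S + f T)
    (A : Finset α) {m : ℝ} (hm : ∀ x, f (A ∪ {x}) ≤ f A + m) (T : Finset α) :
    f (A ∪ T) ≤ f A + T.card * m := by
  induction T using Finset.induction_on with
  | empty => simp
  | insert x T hx ih =>
    have h := hsub (A ∪ T) (A ∪ {x})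
    have hunion : (A ∪ T) ∪ (A ∪ {x}) = A ∪ insert x T := by
      ext y
      simp only [Finset.mem_union, Finset.mem_insert, Finset.mem_singleton]
      tauto
    have hinter : f A ≤ f ((A ∪ T) ∩ (A ∪ {x})) :=
      hmono _ _ (Finset.subset_inter Finset.subset_union_left Finset.subset_union_left)
    rw [hunion] at h
    rw [Finset.card_insert_of_notMem hx]
    push_cast
    linarith [hm x]

/-- Some single element closes at least a `1 / k` fraction of the gap between `f A` and `f T`,
whenever `|T| ≤ k`. -/
theorem submodular_exists_gain {α : Type*} [Finite α] [Nonempty α] [DecidableEq α]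
    {f : Finset α → ℝ}
    (hmono : ∀ S T : Finset α, S ⊆ T → f S ≤ f T)
    (hsub : ∀ S T : Finset α, f (S ∪ T) + f (S ∩ T) ≤ f S + f T)
    {k : ℕ} (hk : 1 ≤ k) (A T : Finset α) (hT : T.card ≤ k) :
    ∃ x, (1 - 1 / (k : ℝ)) * f A + 1 / (k : ℝ) * f T ≤ f (A ∪ {x}) := by
  obtain ⟨x, hx⟩ := Finite.exists_max fun x => f (A ∪ {x})
  refine ⟨x, ?_⟩
  have hk0 : (0 : ℝ) < k := by exact_mod_cast hk
  have hgain := submodular_union_le_add_card_mul hmono hsub A (m := f (A ∪ {x}) - f A)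
    (fun y => by linarith [hx y]) T
  have hm : 0 ≤ f (A ∪ {x}) - f A := sub_nonneg.2 (hmono _ _ Finset.subset_union_left)
  have hcard : (T.card : ℝ) * (f (A ∪ {x}) - f A) ≤ k * (f (A ∪ {x}) - f A) :=
    mul_le_mul_of_nonneg_right (by exact_mod_cast hT) hm
  have hgap : (f T - f A) / k ≤ f (A ∪ {x}) - f A := by
    rw [div_le_iff₀ hk0]
    linarith [hmono T (A ∪ T) Finset.subset_union_right]
  calc (1 - 1 / (k : ℝ)) * f A + 1 / (k : ℝ) * f T = f A + (f T - f A) / k := by ring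
    _ ≤ f (A ∪ {x}) := by linarith

/-- A sequence that starts nonnegative and satisfies `r ((1 - c) a i + c b) ≤ a (i + 1)`
is at least `r ^ i (1 - (1 - c) ^ i) b`. -/
theorem pow_mul_one_sub_pow_mul_le_of_step {a : ℕ → ℝ} {r c b : ℝ} {k : ℕ}
    (hr0 : 0 ≤ r) (hr1 : r ≤ 1) (hc0 : 0 ≤ c) (hc1 : c ≤ 1) (hb : 0 ≤ b) (ha : 0 ≤ a 0)
    (hstep : ∀ i < k, r * ((1 - c) * a i + c * b) ≤ a (i + 1)) :
    ∀ i ≤ k, r ^ i * (1 - (1 - c) ^ i) * b ≤ a i := by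
  intro i
  induction i with
  | zero => intro _; simpa using ha
  | succ i ih =>
    intro hi
    have hpow : r ^ i * (c * b) ≤ c * b :=
      mul_le_of_le_one_left (mul_nonneg hc0 hb) (pow_le_one₀ hr0 hr1)
    have hrec : (1 - c) * (r ^ i * (1 - (1 - c) ^ i) * b) ≤ (1 - c) * a i :=
      mul_le_mul_of_nonneg_left (ih (by omega)) (by linarith)
    calc r ^ (i + 1) * (1 - (1 - c) ^ (i + 1)) * b
        = r * ((1 - c) * (r ^ i * (1 - (1 - c) ^ i) * b) + r ^ i * (c * b)) := by ring
      _ ≤ r * ((1 - c) * a i + c * b) := mul_le_mul_of_nonneg_left (by linarith) hr0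
      _ ≤ a (i + 1) := hstep i (by omega)

/-- Bernoulli-type lower bound for powers of `(1 - d) / (1 + d)`. -/
theorem one_sub_two_mul_le_div_pow {d : ℝ} (hd0 : 0 ≤ d) (hd1 : d ≤ 1) (k : ℕ) :
    1 - 2 * k * d ≤ ((1 - d) / (1 + d)) ^ k := by
  have hd : 0 < 1 + d := by linarith
  have hr : (1 - d) / (1 + d) = 1 + ((1 - d) / (1 + d) - 1) := by ring
  have hr0 : 0 ≤ (1 - d) / (1 + d) := div_nonneg (by linarith) hd.le
  have hlow : 1 - 2 * d ≤ (1 - d) / (1 + d) := by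
    rw [le_div_iff₀ hd]
    nlinarith
  rw [hr]
  refine le_trans ?_ (one_add_mul_le_pow (by linarith) k)
  nlinarith [(Nat.cast_nonneg k : (0 : ℝ) ≤ k)]

/-- Greedy on a surrogate `f̃` with `(1 − 1/n²)f ≤ f̃ ≤ (1 + 1/n²)f` everywhere:
the greedy set `S_k` satisfies
`f(S_k) ≥ ((1 − 1/n²)/(1 + 1/n²))^k (1 − (1 − 1/k)^k) f(S⋆)`, and in particular
`f(S_k) ≥ (1 − 2k/n²)(1 − 1/e) f(S⋆)`, for every `S⋆` with `|S⋆| ≤ k`. -/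
theorem stmt_11 {α : Type*} [Fintype α] [DecidableEq α] (n : ℕ)
    (hn : Fintype.card α = n) (hn1 : 1 ≤ n)
    (f ftil : Finset α → ℝ)
    (hmono : ∀ S T : Finset α, S ⊆ T → f S ≤ f T)
    (hsub : ∀ S T : Finset α, f (S ∪ T) + f (S ∩ T) ≤ f S + f T)
    (hnorm : f ∅ = 0)
    (happrox : ∀ S : Finset α,
      (1 - 1 / (n : ℝ) ^ 2) * f S ≤ ftil S ∧ ftil S ≤ (1 + 1 / (n : ℝ) ^ 2) * f S)
    (k : ℕ) (hk1 : 1 ≤ k) (hkn : k ≤ n)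
    (e : ℕ → α) (S : ℕ → Finset α) (hS0 : S 0 = ∅)
    (hSstep : ∀ i, 1 ≤ i → i ≤ k → S i = S (i - 1) ∪ {e i})
    (hgreedy : ∀ i, 1 ≤ i → i ≤ k → ∀ x : α, ftil (S (i - 1) ∪ {x}) ≤ ftil (S i))
    (Sstar : Finset α) (hstar : Sstar.card ≤ k) :
    ((1 - 1 / (n : ℝ) ^ 2) / (1 + 1 / (n : ℝ) ^ 2)) ^ k
        * (1 - (1 - 1 / (k : ℝ)) ^ k) * f Sstar ≤ f (S k)
    ∧ (1 - 2 * k / (n : ℝ) ^ 2) * (1 - 1 / Real.exp 1) * f Sstar ≤ f (S k) := by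
  have hn0 : (1 : ℝ) ≤ n := by exact_mod_cast hn1
  have hk0 : (1 : ℝ) ≤ k := by exact_mod_cast hk1
  have hα : Nonempty α := Fintype.card_pos_iff.1 (by omega)
  have hd0 : 0 ≤ 1 / (n : ℝ) ^ 2 := by positivity
  have hd1 : 1 / (n : ℝ) ^ 2 ≤ 1 := by
    rw [div_le_one (by positivity)]
    exact one_le_pow₀ hn0
  have hnd : 2 * (k : ℝ) / (n : ℝ) ^ 2 = 2 * k * (1 / (n : ℝ) ^ 2) := by ring
  rw [hnd]
  generalize 1 / (n : ℝ) ^ 2 = d at happrox hd0 hd1 ⊢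
  have hd : 0 < 1 + d := by linarith
  have hr0 : 0 ≤ (1 - d) / (1 + d) := div_nonneg (by linarith) hd.le
  have hr1 : (1 - d) / (1 + d) ≤ 1 := by
    rw [div_le_one hd]
    linarith
  have hb : 0 ≤ f Sstar := hnorm ▸ hmono ∅ Sstar (Finset.empty_subset _)
  have hc1 : 1 / (k : ℝ) ≤ 1 := by
    rw [div_le_one (by linarith)]
    exact hk0
  have hmain : ((1 - d) / (1 + d)) ^ k * (1 - (1 - 1 / (k : ℝ)) ^ k) * f Sstar ≤ f (S k) := by
    refine pow_mul_one_sub_pow_mul_le_of_step (a := fun i => f (S i)) (k := k) hr0 hr1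
      (by positivity) hc1 hb (by simp [hS0, hnorm]) (fun i hi => ?_) k le_rfl
    obtain ⟨x, hx⟩ := submodular_exists_gain hmono hsub hk1 (S i) Sstar hstar
    have hg := hgreedy (i + 1) (by omega) (by omega) x
    rw [Nat.add_sub_cancel] at hg
    refine (mul_le_mul_of_nonneg_left hx hr0).trans ?_
    rw [div_mul_eq_mul_div, div_le_iff₀ hd, mul_comm (f (S (i + 1)))]
    exact (happrox _).1.trans (hg.trans (happrox _).2)
  refine ⟨hmain, le_trans ?_ hmain⟩
  have hexp : (1 - 1 / (k : ℝ)) ^ k ≤ 1 / Real.exp 1 := by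
    simpa [Real.exp_neg] using Real.one_sub_div_pow_le_exp_neg (n := k) (t := 1) hk0
  have he : 0 ≤ 1 - 1 / Real.exp 1 := by
    rw [sub_nonneg, div_le_one (Real.exp_pos 1)]
    exact Real.one_le_exp zero_le_one
  refine mul_le_mul_of_nonneg_right ?_ hb
  calc (1 - 2 * k * d) * (1 - 1 / Real.exp 1)
      ≤ ((1 - d) / (1 + d)) ^ k * (1 - 1 / Real.exp 1) :=
        mul_le_mul_of_nonneg_right (one_sub_two_mul_le_div_pow hd0 hd1 k) he
    _ ≤ ((1 - d) / (1 + d)) ^ k * (1 - (1 - 1 / (k : ℝ)) ^ k) :=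
        mul_le_mul_of_nonneg_left (by linarith) (pow_nonneg hr0 k)
end

section
/- Let N be a finite set with |N| = n ≥ 1 and let f : 2^N → ℝ be additive with nonnegative values, i.e., f(S) = Σ_{e ∈ S} f({e}) with f({e}) ≥ 0 for all e. Let f̃ : 2^N → ℝ satisfy (1 − 1/n²)·f(S) ≤ f̃(S) ≤ (1 + 1/n²)·f(S) for every S ⊆ N. Let 1 ≤ k ≤ n and let S ⊆ N be a k-element set maximizing Σ_{e ∈ S} f̃({e}) over all k-element subsets of N. Then for every S⋆ ⊆ N with |S⋆| ≤ k: f(S) ≥ ((1 − 1/n²)/(1 + 1/n²)) · f(S⋆). -/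
/-- For a nonnegative additive `f` and a surrogate `f̃` with
`(1 − 1/n²)f ≤ f̃ ≤ (1 + 1/n²)f` everywhere, a `k`-element set `S` maximizing
`Σ_{e ∈ S} f̃({e})` satisfies `f(S) ≥ ((1 − 1/n²)/(1 + 1/n²)) · f(S⋆)` for every
`S⋆` with `|S⋆| ≤ k`. -/
theorem stmt_12 {α : Type*} [Fintype α] [DecidableEq α] (n : ℕ)
    (hn : Fintype.card α = n) (hn1 : 1 ≤ n)
    (f ftil : Finset α → ℝ)
    (hadd : ∀ S : Finset α, f S = ∑ x ∈ S, f {x})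
    (hnn : ∀ x : α, 0 ≤ f {x})
    (happrox : ∀ S : Finset α,
      (1 - 1 / (n : ℝ) ^ 2) * f S ≤ ftil S ∧ ftil S ≤ (1 + 1 / (n : ℝ) ^ 2) * f S)
    (k : ℕ) (hk1 : 1 ≤ k) (hkn : k ≤ n)
    (S : Finset α) (hScard : S.card = k)
    (hmax : ∀ T : Finset α, T.card = k → ∑ x ∈ T, ftil {x} ≤ ∑ x ∈ S, ftil {x})
    (Sstar : Finset α) (hstar : Sstar.card ≤ k) :
    ((1 - 1 / (n : ℝ) ^ 2) / (1 + 1 / (n : ℝ) ^ 2)) * f Sstar ≤ f S := by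
  obtain ⟨T, hsub, hTcard⟩ := Finset.exists_superset_card_eq hstar (hn.symm ▸ hkn)
  have hmono : f Sstar ≤ f T := by
    rw [hadd Sstar, hadd T]
    exact Finset.sum_le_sum_of_subset_of_nonneg hsub fun x _ _ => hnn x
  have hlow : (1 - 1 / (n : ℝ) ^ 2) * f T ≤ ∑ x ∈ T, ftil {x} := by
    rw [hadd T, Finset.mul_sum]
    exact Finset.sum_le_sum fun x _ => (happrox {x}).1
  have hupp : ∑ x ∈ S, ftil {x} ≤ (1 + 1 / (n : ℝ) ^ 2) * f S := by
    rw [hadd S, Finset.mul_sum]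
    exact Finset.sum_le_sum fun x _ => (happrox {x}).2
  have hcoef : 0 ≤ 1 - 1 / (n : ℝ) ^ 2 := by
    have hn' : (1 : ℝ) ≤ (n : ℝ) ^ 2 := one_le_pow₀ (by exact_mod_cast hn1)
    exact sub_nonneg.2 ((div_le_one (by positivity)).2 hn')
  rw [div_mul_eq_mul_div, div_le_iff₀' (by positivity)]
  calc (1 - 1 / (n : ℝ) ^ 2) * f Sstar ≤ (1 - 1 / (n : ℝ) ^ 2) * f T :=
        mul_le_mul_of_nonneg_left hmono hcoef
    _ ≤ ∑ x ∈ T, ftil {x} := hlow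
    _ ≤ ∑ x ∈ S, ftil {x} := hmax T hTcard
    _ ≤ (1 + 1 / (n : ℝ) ^ 2) * f S := hupp
end

section
/- Let N be a finite set and let f : 2^N → ℝ be monotone, submodular, and normalized, with curvature at most c for some c ∈ [0,1], i.e., f(S ∪ {e}) − f(S) ≥ (1 − c)·f({e}) for every S ⊆ N and e ∈ N∖S. Let q : N → (0,1) define product-distribution weights w(S) = Π_{e ∈ S} q(e) · Π_{e ∉ S} (1 − q(e)), and for each e ∈ N let v(e) = (Σ_{S ⊆ N, e ∉ S} w(S)·(f(S ∪ {e}) − f(S))) / (Σ_{S ⊆ N, e ∉ S} w(S)) be the exact expected marginal contribution of e to a random set. Let 1 ≤ k ≤ |N| and let S be a k-element subset of N maximizing Σ_{e ∈ S} v(e) over all k-element subsets. Then for every S⋆ ⊆ N with |S⋆| = k: f(S) ≥ (1 − c)² · f(S⋆). -/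
/-- The marginal contribution of `e` to a set avoiding it is at most `f {e}`. -/
theorem marginal_le_singleton {α : Type*} [DecidableEq α] {f : Finset α → ℝ}
    (hsub : ∀ S T : Finset α, f (S ∪ T) + f (S ∩ T) ≤ f S + f T) (hnorm : f ∅ = 0)
    {S : Finset α} {e : α} (he : e ∉ S) : f (insert e S) - f S ≤ f {e} := by
  have h := hsub S {e}
  rw [Finset.union_comm, ← Finset.insert_eq, Finset.inter_singleton_of_notMem he, hnorm] at h
  linarith

theorem le_sum_singleton {α : Type*} [DecidableEq α] {f : Finset α → ℝ}
    (hsub : ∀ S T : Finset α, f (S ∪ T) + f (S ∩ T) ≤ f S + f T) (hnorm : f ∅ = 0)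
    (S : Finset α) : f S ≤ ∑ x ∈ S, f {x} := by
  induction S using Finset.induction_on with
  | empty => simp [hnorm]
  | insert e S he ih =>
    rw [Finset.sum_insert he]
    linarith [marginal_le_singleton hsub hnorm he]

theorem mul_sum_singleton_le {α : Type*} [DecidableEq α] {f : Finset α → ℝ} {b : ℝ}
    (hnorm : f ∅ = 0)
    (hcurv : ∀ S : Finset α, ∀ e : α, e ∉ S → b * f {e} ≤ f (insert e S) - f S)
    (S : Finset α) : b * ∑ x ∈ S, f {x} ≤ f S := by
  induction S using Finset.induction_on with
  | empty => simp [hnorm]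
  | insert e S he ih =>
    rw [Finset.sum_insert he, mul_add]
    linarith [hcurv S e he]

/-- A weighted average of values in `[a, b]` lies in `[a, b]`. -/
theorem weighted_average_mem_Icc {ι : Type*} {s : Finset ι} {w g : ι → ℝ} {a b : ℝ}
    (hw : ∀ i ∈ s, 0 ≤ w i) (hpos : 0 < ∑ i ∈ s, w i) (hg : ∀ i ∈ s, g i ∈ Set.Icc a b) :
    (∑ i ∈ s, w i * g i) / (∑ i ∈ s, w i) ∈ Set.Icc a b := by
  rw [Set.mem_Icc, le_div_iff₀ hpos, div_le_iff₀ hpos, Finset.mul_sum, Finset.mul_sum]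
  constructor <;> refine Finset.sum_le_sum fun i hi => ?_
  · rw [mul_comm a]
    exact mul_le_mul_of_nonneg_left (hg i hi).1 (hw i hi)
  · rw [mul_comm b]
    exact mul_le_mul_of_nonneg_left (hg i hi).2 (hw i hi)

/-- MaxMargCont with exact expected marginal contributions: for monotone, submodular,
normalized `f` with curvature at most `c`, the `k`-element set maximizing the sum of
exact expected marginal contributions `v(e)` under a product distribution is a
`(1 − c)²`-approximation to the optimum over `k`-element sets. -/
theorem stmt_14 {α : Type*} [Fintype α] [DecidableEq α]
    (f : Finset α → ℝ)
    (hmono : ∀ S T : Finset α, S ⊆ T → f S ≤ f T)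
    (hsub : ∀ S T : Finset α, f (S ∪ T) + f (S ∩ T) ≤ f S + f T)
    (hnorm : f ∅ = 0)
    (c : ℝ) (hc0 : 0 ≤ c) (hc1 : c ≤ 1)
    (hcurv : ∀ S : Finset α, ∀ e : α, e ∉ S → (1 - c) * f {e} ≤ f (insert e S) - f S)
    (q : α → ℝ) (hq : ∀ x, 0 < q x ∧ q x < 1)
    (w : Finset α → ℝ)
    (hw : ∀ S : Finset α, w S = (∏ x ∈ S, q x) * ∏ x ∈ Sᶜ, (1 - q x))
    (v : α → ℝ)
    (hv : ∀ e : α, v e =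
      (∑ S ∈ Finset.univ.filter (fun S : Finset α => e ∉ S), w S * (f (insert e S) - f S)) /
        (∑ S ∈ Finset.univ.filter (fun S : Finset α => e ∉ S), w S))
    (k : ℕ) (hk1 : 1 ≤ k) (hkn : k ≤ Fintype.card α)
    (S : Finset α) (hScard : S.card = k)
    (hmax : ∀ T : Finset α, T.card = k → ∑ x ∈ T, v x ≤ ∑ x ∈ S, v x)
    (Sstar : Finset α) (hstar : Sstar.card = k) :
    (1 - c) ^ 2 * f Sstar ≤ f S := by
  have hwpos (T : Finset α) : 0 < w T := by
    rw [hw]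
    exact mul_pos (Finset.prod_pos fun x _ => (hq x).1)
      (Finset.prod_pos fun x _ => sub_pos.2 (hq x).2)
  have hvmem (e : α) : v e ∈ Set.Icc ((1 - c) * f {e}) (f {e}) := by
    rw [hv]
    refine weighted_average_mem_Icc (fun T _ => (hwpos T).le)
      (Finset.sum_pos (fun T _ => hwpos T) ⟨∅, by simp⟩) fun T hT => ?_
    have he : e ∉ T := (Finset.mem_filter.1 hT).2
    exact ⟨hcurv T e he, marginal_le_singleton hsub hnorm he⟩
  have hb : 0 ≤ 1 - c := sub_nonneg.2 hc1
  calc (1 - c) ^ 2 * f Sstar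
      ≤ (1 - c) ^ 2 * ∑ x ∈ Sstar, f {x} := by
        gcongr
        exact le_sum_singleton hsub hnorm Sstar
    _ = (1 - c) * ∑ x ∈ Sstar, (1 - c) * f {x} := by
        rw [← Finset.mul_sum]
        ring
    _ ≤ (1 - c) * ∑ x ∈ Sstar, v x := by
        gcongr with x
        exact (hvmem x).1
    _ ≤ (1 - c) * ∑ x ∈ S, v x := by
        exact mul_le_mul_of_nonneg_left (hmax Sstar hstar) hb
    _ ≤ (1 - c) * ∑ x ∈ S, f {x} := by
        gcongr with x
        exact (hvmem x).2
    _ ≤ f S := mul_sum_singleton_le hnorm hcurv S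
end

section
/- Let N be a finite set partitioned into three pairwise disjoint sets A (good elements), B (bad elements), and M (masking elements). Let s be a positive integer and let c, d ≥ 0 be real numbers satisfying |A| + c ≤ d·s. Define f : 2^N → ℝ by f(S) = (1 − min(1, |S ∩ M|/s)) · (|S ∩ A| + min(|S ∩ B|, c)) + d · min(s, |S ∩ M|). Then f is monotone and submodular: for all S ⊆ T ⊆ N and e ∈ N∖T, one has 0 ≤ f(T ∪ {e}) − f(T) ≤ f(S ∪ {e}) − f(S). (The paper instantiates this with |A| = k = n^{1/4 − ε/2}, c = log n, s = n^{1/2}, d = n^{−1/4}, giving the class of monotone submodular functions underlying the n^{−1/4 + ε} hardness of optimization from samples for monotone submodular functions.) -/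
/-- Truncation has decreasing increments. -/
theorem min_add_sub_min_le {x y h c : ℝ} (hxy : x ≤ y) (hh : 0 ≤ h) :
    min (y + h) c - min y c ≤ min (x + h) c - min x c := by
  rcases min_cases (y + h) c with h1 | h1 <;> rcases min_cases y c with h2 | h2 <;>
    rcases min_cases (x + h) c with h3 | h3 <;> rcases min_cases x c with h4 | h4 <;> linarith

theorem Finset.card_insert_inter_of_mem {α : Type*} [DecidableEq α] {S X : Finset α} {e : α}
    (hS : e ∉ S) (hX : e ∈ X) : (((insert e S) ∩ X).card : ℝ) = (S ∩ X).card + 1 := by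
  rw [Finset.insert_inter_of_mem hX, Finset.card_insert_of_notMem (by simp [hS])]
  push_cast
  rfl


/-- The hardness construction for monotone submodular functions: with `N` partitioned into
good elements `A`, bad elements `B`, and masking elements `M`, `s ≥ 1`, `c, d ≥ 0` with
`|A| + c ≤ d·s`, the function
`f(S) = (1 − min(1, |S∩M|/s))·(|S∩A| + min(|S∩B|, c)) + d·min(s, |S∩M|)`
is monotone and submodular (nonnegative, decreasing marginals). -/
theorem stmt_16 {α : Type*} [Fintype α] [DecidableEq α]
    (A B M : Finset α) (hAB : Disjoint A B) (hAM : Disjoint A M) (hBM : Disjoint B M)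
    (hcover : A ∪ B ∪ M = Finset.univ)
    (s : ℕ) (hs : 1 ≤ s) (c d : ℝ) (hc : 0 ≤ c) (hd : 0 ≤ d)
    (hbound : (A.card : ℝ) + c ≤ d * s)
    (f : Finset α → ℝ)
    (hf : ∀ S : Finset α, f S =
      (1 - min 1 (((S ∩ M).card : ℝ) / s)) *
          (((S ∩ A).card : ℝ) + min (((S ∩ B).card : ℝ)) c)
        + d * min (s : ℝ) (((S ∩ M).card : ℝ))) :
    ∀ S T : Finset α, S ⊆ T → ∀ e : α, e ∉ T →
      0 ≤ f (insert e T) - f T ∧ f (insert e T) - f T ≤ f (insert e S) - f S := by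
  intro S T hST e heT
  have heS : e ∉ S := fun h => heT (hST h)
  have hs0 : (0 : ℝ) < s := by exact_mod_cast hs
  have hcard (X : Finset α) : ((S ∩ X).card : ℝ) ≤ (T ∩ X).card := by
    exact_mod_cast Finset.card_le_card (Finset.inter_subset_inter_right hST)
  -- `f` is `d * s` minus a product of two nonnegative antitone functions.
  set u : Finset α → ℝ := fun X => 1 - min 1 (((X ∩ M).card : ℝ) / s) with hu
  set v : Finset α → ℝ := fun X => ((X ∩ A).card : ℝ) + min (((X ∩ B).card : ℝ)) c with hv
  have hf' (X : Finset α) : f X = d * s - u X * (d * s - v X) := by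
    have h : min (s : ℝ) ((X ∩ M).card : ℝ) = s * min 1 (((X ∩ M).card : ℝ) / s) := by
      rw [mul_min_of_nonneg _ _ hs0.le, mul_one, mul_div_cancel₀ _ hs0.ne']
    rw [hf, h]
    simp only [hu, hv]
    ring
  have hu0 (X : Finset α) : 0 ≤ u X := sub_nonneg.2 (min_le_left _ _)
  have huST : u T ≤ u S :=
    sub_le_sub_left (min_le_min_left _ (div_le_div_of_nonneg_right (hcard M) hs0.le)) _
  have hvT : v T ≤ d * s := by
    have h : ((T ∩ A).card : ℝ) ≤ A.card := by
      exact_mod_cast Finset.card_le_card Finset.inter_subset_right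
    exact (add_le_add h (min_le_right _ _)).trans hbound
  have hvST : v S ≤ v T := add_le_add (hcard A) (min_le_min_right _ (hcard B))
  by_cases heM : e ∈ M
  · have heA : e ∉ A := Finset.disjoint_right.1 hAM heM
    have heB : e ∉ B := Finset.disjoint_right.1 hBM heM
    have hv' (X : Finset α) : v (insert e X) = v X := by
      simp only [hv, Finset.insert_inter_of_notMem heA, Finset.insert_inter_of_notMem heB]
    have hanti : u (insert e T) ≤ u T := by
      simp only [hu, Finset.card_insert_inter_of_mem heT heM]
      gcongr
      linarith
    have hinc : u T - u (insert e T) ≤ u S - u (insert e S) := by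
      simp only [hu, Finset.card_insert_inter_of_mem heT heM,
        Finset.card_insert_inter_of_mem heS heM, add_div]
      have := min_add_sub_min_le (c := 1) (div_le_div_of_nonneg_right (hcard M) hs0.le)
        (one_div_nonneg.2 hs0.le)
      simp only [min_comm (1 : ℝ)]
      linarith
    have hgain (X : Finset α) :
        f (insert e X) - f X = (u X - u (insert e X)) * (d * s - v X) := by
      rw [hf', hf', hv']
      ring
    rw [hgain, hgain]
    exact ⟨mul_nonneg (sub_nonneg.2 hanti) (sub_nonneg.2 hvT),
      mul_le_mul hinc (by linarith) (sub_nonneg.2 hvT) (by linarith)⟩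
  · have hu' (X : Finset α) : u (insert e X) = u X := by
      simp only [hu, Finset.insert_inter_of_notMem heM]
    have hgain (X : Finset α) : f (insert e X) - f X = u X * (v (insert e X) - v X) := by
      rw [hf', hf', hu']
      ring
    have hv' : 0 ≤ v (insert e T) - v T ∧ v (insert e T) - v T ≤ v (insert e S) - v S := by
      by_cases heA : e ∈ A
      · have heB : e ∉ B := Finset.disjoint_left.1 hAB heA
        simp only [hv, Finset.insert_inter_of_notMem heB,
          Finset.card_insert_inter_of_mem heT heA, Finset.card_insert_inter_of_mem heS heA]
        constructor <;> linarith
      · have heB : e ∈ B := by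
          have := Finset.mem_univ e
          simpa [← hcover, heA, heM] using this
        simp only [hv, Finset.insert_inter_of_notMem heA,
          Finset.card_insert_inter_of_mem heT heB, Finset.card_insert_inter_of_mem heS heB,
          add_sub_add_left_eq_sub]
        exact ⟨sub_nonneg.2 (min_le_min_right _ (by linarith)),
          min_add_sub_min_le (hcard B) zero_le_one⟩
    rw [hgain, hgain]
    exact ⟨mul_nonneg (hu0 T) hv'.1, mul_le_mul huST hv'.2 hv'.1 (hu0 S)⟩
end
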